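/- arXiv:1207.4302 — 2 statements merged into one kernel-verified Lean document; each statement's English description precedes it below -/
import Mathlib

section
/- If f is a normalized analytic function on the unit disk 𝔻 that is starlike of order 1/2 (f(z) ≠ 0 and Re(z f'(z)/f(z)) > 1/2 for all 0 < |z| < 1), and λ ≥ 0, μ ≥ 0 are real numbers with λ + μ > 0, then for every n ≥ 2 and every z with 0 < |z| < 1 one has Re(λ · z f'(z)/f(z) + μ · f_n(z)/f(z)) > 0. -/
open Complex Metric Finset

lemma differentiableOn_of_hasSum_pow {f : ℂ → ℂ} {a : ℕ → ℂ}
    (hf : ∀ z ∈ ball (0:ℂ) 1, HasSum (fun k => a k * z ^ k) (f z)) :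
    DifferentiableOn ℂ f (ball 0 1) := by
  intro z hz
  obtain ⟨r, hzr, hr⟩ := exists_between (mem_ball_zero_iff.mp hz)
  have hr0 : 0 < r := (norm_nonneg z).trans_lt hzr
  have hrb : (r : ℂ) ∈ ball (0:ℂ) 1 := by simpa [abs_of_pos hr0] using hr
  have hd : DifferentiableOn ℂ (fun w => ∑' k, a k * w ^ k) (ball 0 r) :=
    differentiableOn_tsum_of_summable_norm (hf r hrb).summable.norm
      (fun k => by fun_prop) isOpen_ball fun k w hw => by
        rw [norm_mul, norm_mul, norm_pow, norm_pow, norm_real, Real.norm_of_nonneg hr0.le]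
        have := mem_ball_zero_iff.mp hw
        gcongr
  have hnhds : ball (0:ℂ) r ∈ nhds z := isOpen_ball.mem_nhds (mem_ball_zero_iff.mpr hzr)
  refine ((hd.differentiableAt hnhds).congr_of_eventuallyEq ?_).differentiableWithinAt
  filter_upwards [hnhds] with w hw
  exact (hf w (ball_subset_ball hr.le hw)).tsum_eq.symm

lemma integral_exp_int_mul_I (j : ℤ) :
    ∫ t in (0:ℝ)..2 * Real.pi, exp (j * (t * I)) = if j = 0 then 2 * (Real.pi : ℂ) else 0 := by
  split_ifs with hj
  · simp [hj]
  · have hc : (j : ℂ) * I ≠ 0 := mul_ne_zero (mod_cast hj) I_ne_zero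
    have h := integral_exp_mul_complex (a := 0) (b := 2 * Real.pi) hc
    have he : exp (j * I * (2 * Real.pi : ℝ)) = 1 := by
      rw [← exp_int_mul_two_pi_mul_I j]; push_cast; ring_nf
    rw [he] at h
    simp only [ofReal_zero, mul_zero, exp_zero, sub_self, zero_div] at h
    rw [← h]
    congr 1; ext t; ring_nf

lemma norm_exp_ofReal_mul_I_mul (t : ℝ) (z : ℂ) : ‖exp (t * I) * z‖ = ‖z‖ := by
  rw [norm_mul, norm_exp_ofReal_mul_I, one_mul]

lemma hasSum_integral_exp_mul {f : ℂ → ℂ} {a : ℕ → ℂ}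
    (hf : ∀ z ∈ ball (0:ℂ) 1, HasSum (fun k => a k * z ^ k) (f z)) {z : ℂ}
    (hz : z ∈ ball (0:ℂ) 1) (j : ℤ) :
    HasSum (fun k : ℕ => a k * z ^ k * if j + k = 0 then 2 * (Real.pi : ℂ) else 0)
      (∫ t in (0:ℝ)..2 * Real.pi, exp (j * (t * I)) * f (exp (t * I) * z)) := by
  have key := intervalIntegral.hasSum_integral_of_dominated_convergence
    (μ := MeasureTheory.volume) (a := 0) (b := 2 * Real.pi)
    (F := fun (k : ℕ) (t : ℝ) => exp (j * (t * I)) * (a k * (exp (t * I) * z) ^ k))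
    (f := fun t : ℝ => exp (j * (t * I)) * f (exp (t * I) * z))
    (fun k _ => ‖a k * z ^ k‖) (fun k => by fun_prop)
    (fun k => Filter.Eventually.of_forall fun t _ => ?_)
    (Filter.Eventually.of_forall fun t _ => (hf z hz).summable.norm)
    (by simp) (Filter.Eventually.of_forall fun t _ => (hf _ ?_).mul_left _)
  · refine (congrArg (HasSum · _) (funext fun k => ?_)).mpr key
    rw [← integral_exp_int_mul_I (j + k),
      ← intervalIntegral.integral_const_mul]
    congr 1; ext t
    rw [mul_pow, ← exp_nat_mul]
    push_cast
    rw [add_mul, exp_add]; ring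
  · have h : ‖exp (j * (t * I))‖ = 1 := by
      rw [← norm_exp_ofReal_mul_I (j * t)]; push_cast; ring_nf
    rw [norm_mul, h, one_mul, norm_mul, norm_pow, norm_exp_ofReal_mul_I_mul, norm_mul, norm_pow]
  · rw [mem_ball_zero_iff, norm_exp_ofReal_mul_I_mul]
    exact mem_ball_zero_iff.mp hz

/-- A Laurent polynomial in `y = exp (t * I)` equal to `-2 * (1 - cos (n * t)) / (1 - y)`. -/
noncomputable def partialSumKernel (n : ℕ) (t : ℝ) : ℂ :=
  ∑ j ∈ range n, (exp ((-(j + 1 : ℤ) : ℤ) * (t * I)) - exp ((j : ℤ) * (t * I)))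

lemma continuous_partialSumKernel (n : ℕ) : Continuous (partialSumKernel n) := by
  unfold partialSumKernel; fun_prop

lemma partialSumKernel_two_pi (n : ℕ) : partialSumKernel n (2 * Real.pi) = 0 := by
  refine sum_eq_zero fun j _ => ?_
  rw [ofReal_mul, ofReal_ofNat, exp_int_mul_two_pi_mul_I, exp_int_mul_two_pi_mul_I, sub_self]

lemma partialSumKernel_mul (n : ℕ) (t : ℝ) :
    partialSumKernel n t * (exp (t * I) - 1) = 2 * (1 - Real.cos (n * t)) := by
  have hn : partialSumKernel n t * (exp (t * I) - 1) =
      2 - exp (n * (t * I)) - exp (-(n * (t * I))) := by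
    unfold partialSumKernel
    induction n with
    | zero => norm_num
    | succ n ih =>
      rw [sum_range_succ, add_mul, ih]
      push_cast
      have h1 : exp (-((n:ℂ) * (t * I))) = exp (-((n + 1 : ℂ) * (t * I))) * exp (t * I) := by
        rw [← exp_add]; ring_nf
      have h2 : exp ((n + 1 : ℂ) * (t * I)) = exp (n * (t * I)) * exp (t * I) := by
        rw [← exp_add]; ring_nf
      rw [h1, h2, neg_mul]
      ring
  rw [hn]
  push_cast
  rw [mul_sub, two_cos]
  ring_nf

lemma integral_partialSumKernel_mul {f : ℂ → ℂ} {a : ℕ → ℂ} (ha0 : a 0 = 0)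
    (hf : ∀ z ∈ ball (0:ℂ) 1, HasSum (fun k => a k * z ^ k) (f z)) {z : ℂ}
    (hz : z ∈ ball (0:ℂ) 1) (hc : Continuous fun t : ℝ => f (exp (t * I) * z)) (n : ℕ) :
    ∫ t in (0:ℝ)..2 * Real.pi, partialSumKernel n t * f (exp (t * I) * z) =
      2 * Real.pi * ∑ k ∈ range (n + 1), a k * z ^ k := by
  have hneg (j : ℕ) :
      ∫ t in (0:ℝ)..2 * Real.pi, exp ((-(j + 1 : ℤ) : ℤ) * (t * I)) * f (exp (t * I) * z) =
        2 * Real.pi * (a (j + 1) * z ^ (j + 1)) := by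
    refine (hasSum_integral_exp_mul hf hz _).unique ?_
    convert hasSum_single (j + 1) fun k hk => ?_ using 1
    · rw [if_pos (by push_cast; ring)]; ring
    · rw [if_neg (by omega), mul_zero]
  have hpos (j : ℕ) :
      ∫ t in (0:ℝ)..2 * Real.pi, exp ((j : ℤ) * (t * I)) * f (exp (t * I) * z) = 0 := by
    refine (hasSum_integral_exp_mul hf hz _).unique ?_
    convert hasSum_zero with k
    rcases eq_or_ne k 0 with rfl | hk
    · simp [ha0]
    · rw [if_neg (by omega), mul_zero]
  have hint (j : ℤ) : IntervalIntegrable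
      (fun t : ℝ => exp (j * (t * I)) * f (exp (t * I) * z)) MeasureTheory.volume
      0 (2 * Real.pi) :=
    (Continuous.mul (by fun_prop) hc).intervalIntegrable _ _
  unfold partialSumKernel
  simp_rw [sum_mul, sub_mul]
  rw [intervalIntegral.integral_finsetSum fun j _ => (hint _).sub (hint _)]
  rw [sum_range_succ', ha0, zero_mul, add_zero, mul_sum]
  refine sum_congr rfl fun j _ => ?_
  rw [intervalIntegral.integral_sub (hint _) (hint _), hneg, hpos, sub_zero]

lemma exists_eq_mul_exp {h : ℂ → ℂ} (hdiff : DifferentiableOn ℂ h (ball 0 1))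
    (h0 : ∀ z ∈ ball (0:ℂ) 1, h z ≠ 0) :
    ∃ (c : ℂ) (H : ℂ → ℂ), DifferentiableOn ℂ H (ball 0 1) ∧
      ∀ z ∈ ball (0:ℂ) 1, h z = c * exp (H z) := by
  obtain ⟨H, hH⟩ := ((hdiff.deriv isOpen_ball).div hdiff h0).isExactOn_ball
  have hq : ∀ z ∈ ball (0:ℂ) 1, HasDerivAt (fun z => h z * exp (-H z)) 0 z := fun z hz => by
    refine ((hdiff.hasDerivAt (isOpen_ball.mem_nhds hz)).mul (hH z hz).neg.cexp).congr_deriv ?_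
    have := h0 z hz
    simp only [Pi.div_apply]
    field_simp
    ring
  refine ⟨h 0 * exp (-H 0), H, fun z hz => (hH z hz).differentiableAt.differentiableWithinAt,
    fun z hz => ?_⟩
  have hconst : h z * exp (-H z) = h 0 * exp (-H 0) :=
    (convex_ball (0:ℂ) 1).is_const_of_fderivWithin_eq_zero (𝕜 := ℂ)
      (f := fun z => h z * exp (-H z))
      (fun w hw => (hq w hw).differentiableAt.differentiableWithinAt)
      (fun w hw => by
        rw [fderivWithin_of_isOpen isOpen_ball hw]
        ext; simp [(hq w hw).deriv]) hz (mem_ball_self one_pos)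
  rw [← hconst, mul_assoc, ← exp_add]
  simp

lemma hasSum_pow_succ {f : ℂ → ℂ} {a : ℕ → ℂ} (ha0 : a 0 = 0)
    (hf : ∀ z ∈ ball (0:ℂ) 1, HasSum (fun k => a k * z ^ k) (f z)) {z : ℂ}
    (hz : z ∈ ball (0:ℂ) 1) :
    HasSum (fun k => a (k + 1) * z ^ k) (if z = 0 then a 1 else f z / z) := by
  split_ifs with hz0
  · subst hz0
    simpa using hasSum_single (f := fun k => a (k + 1) * (0:ℂ) ^ k) 0 fun k hk => by simp [hk]
  · have h := ((hasSum_nat_add_iff' 1).mpr (hf z hz)).div_const z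
    simp only [sum_range_one, ha0, zero_mul, sub_zero] at h
    refine (congrArg (HasSum · _) (funext fun k => ?_)).mpr h
    field_simp
    ring

/-- If `f = z * (c * exp H)` is starlike of order `1/2`, then
`f (exp (t * I) * z) / f z = exp (t * I / 2) * exp (argLift H z t)`. -/
noncomputable def argLift (H : ℂ → ℂ) (z : ℂ) (t : ℝ) : ℂ :=
  t / 2 * I + (H (exp (t * I) * z) - H z)

lemma mul_deriv_div_eq {f H : ℂ → ℂ} {c : ℂ} (hH : DifferentiableOn ℂ H (ball 0 1))
    (hfH : ∀ z ∈ ball (0:ℂ) 1, f z = z * (c * exp (H z))) {z : ℂ} (hz : z ∈ ball (0:ℂ) 1)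
    (hfz : f z ≠ 0) : z * deriv f z / f z = 1 + z * deriv H z := by
  have hnhds := isOpen_ball.mem_nhds hz
  have hd := (hasDerivAt_id z).mul (((hH.hasDerivAt hnhds).cexp).const_mul c)
  have hder : deriv f z = 1 * (c * exp (H z)) + z * (c * (exp (H z) * deriv H z)) := by
    refine (hd.congr_of_eventuallyEq ?_).deriv
    filter_upwards [hnhds] with w hw
    simpa using hfH w hw
  rw [div_eq_iff hfz, hder, hfH z hz]
  ring

lemma strictMono_argLift_im {H : ℂ → ℂ} (hH : DifferentiableOn ℂ H (ball 0 1))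
    {z : ℂ} (hz : z ∈ ball (0:ℂ) 1)
    (hre : ∀ t : ℝ, -(1 / 2) < (exp (t * I) * z * deriv H (exp (t * I) * z)).re) :
    StrictMono fun t => (argLift H z t).im := by
  have hd (t : ℝ) : HasDerivAt (fun t => (argLift H z t).im)
      (1 / 2 + (exp (t * I) * z * deriv H (exp (t * I) * z)).re) t := by
    have hmem : exp (t * I) * z ∈ ball (0:ℂ) 1 := by
      rw [mem_ball_zero_iff, norm_exp_ofReal_mul_I_mul]; exact mem_ball_zero_iff.mp hz
    have ht : HasDerivAt (fun t : ℂ => exp (t * I) * z) (exp (t * I) * (1 * I) * z) (t : ℂ) :=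
      (((hasDerivAt_id (t : ℂ)).mul_const I).cexp).mul_const z
    have hc := ((hH.hasDerivAt (isOpen_ball.mem_nhds hmem)).comp (t : ℂ) ht).sub_const (H z)
    have ha := ((((hasDerivAt_id (t : ℂ)).div_const 2).mul_const I).add hc).comp_ofReal
    have him := imCLM.hasFDerivAt.comp_hasDerivAt t ha
    refine him.congr_deriv ?_
    simp [mul_re, mul_im]
    ring
  refine strictMono_of_deriv_pos fun t => ?_
  rw [(hd t).deriv]
  linarith [hre t]

lemma sin_mul_re_partialSumKernel_mul {f H : ℂ → ℂ} {c : ℂ}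
    (hfH : ∀ z ∈ ball (0:ℂ) 1, f z = z * (c * exp (H z))) {z : ℂ} (hz : z ∈ ball (0:ℂ) 1)
    (hfz : f z ≠ 0) (n : ℕ) (t : ℝ) :
    Real.sin (t / 2) * (partialSumKernel n t * (f (exp (t * I) * z) / f z)).re =
      (1 - Real.cos (n * t)) *
        (Real.exp (argLift H z t).re * Real.sin (argLift H z t).im) := by
  have hmem : exp (t * I) * z ∈ ball (0:ℂ) 1 := by
    rw [mem_ball_zero_iff, norm_exp_ofReal_mul_I_mul]; exact mem_ball_zero_iff.mp hz
  have hE : exp (t / 2 * I) * exp (t / 2 * I) = exp (t * I) := by rw [← exp_add]; ring_nf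
  have hsin : exp (t * I) - 1 = 2 * I * Real.sin (t / 2) * exp (t / 2 * I) := by
    have h2 := two_sin (t / 2 : ℂ)
    have h1 : exp (-(t / 2 : ℂ) * I) * exp (t / 2 * I) = 1 := by rw [← exp_add]; simp
    push_cast
    rw [← hE]
    linear_combination (-I * exp (t / 2 * I)) * h2 - I ^ 2 * h1 +
      (exp (t / 2 * I) * exp (t / 2 * I) - 1) * I_sq
  have hratio : f (exp (t * I) * z) / f z = exp (t / 2 * I) * exp (argLift H z t) := by
    rw [div_eq_iff hfz, hfH _ hmem, hfH z hz]
    have : exp (H (exp (t * I) * z)) = exp (H (exp (t * I) * z) - H z) * exp (H z) := by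
      rw [← exp_add]; simp
    rw [argLift, exp_add, this]
    linear_combination (-z * c * exp (H (exp (t * I) * z) - H z) * exp (H z)) * hE
  have hk := partialSumKernel_mul n t
  have hcomb : Real.sin (t / 2) * (partialSumKernel n t * (f (exp (t * I) * z) / f z)) =
      (1 - Real.cos (n * t) : ℝ) * (-I * exp (argLift H z t)) := by
    rw [hsin] at hk
    rw [hratio]
    push_cast at hk ⊢
    linear_combination (-I / 2 * exp (argLift H z t)) * hk + (sin (t / 2) *
      (partialSumKernel n t * (exp (t / 2 * I) * exp (argLift H z t)))) * I_sq
  have := congrArg re hcomb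
  rw [re_ofReal_mul, re_ofReal_mul] at this
  rw [this]
  simp [exp_im]

theorem re_partialSum_div_pos {f : ℂ → ℂ} {a : ℕ → ℂ} (ha0 : a 0 = 0) (ha1 : a 1 = 1)
    (hf : ∀ z ∈ ball (0:ℂ) 1, HasSum (fun k => a k * z ^ k) (f z))
    (hstar : ∀ z ∈ ball (0:ℂ) 1, z ≠ 0 → f z ≠ 0 ∧ 1/2 < (z * deriv f z / f z).re)
    {n : ℕ} (hn : n ≠ 0) {z : ℂ} (hz : z ∈ ball (0:ℂ) 1) (hz0 : z ≠ 0) :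
    0 < ((∑ k ∈ range (n + 1), a k * z ^ k) / f z).re := by
  have hdf := differentiableOn_of_hasSum_pow hf
  have hfz := (hstar z hz hz0).1
  obtain ⟨c, H, hH, hcH⟩ := exists_eq_mul_exp
    (differentiableOn_of_hasSum_pow fun w hw => hasSum_pow_succ ha0 hf hw) fun w hw => by
      split_ifs with hw0
      · simp [ha1]
      · exact div_ne_zero (hstar w hw hw0).1 hw0
  have hfH (w : ℂ) (hw : w ∈ ball (0:ℂ) 1) : f w = w * (c * exp (H w)) := by
    rw [← hcH w hw]
    split_ifs with hw0
    · have := (hf w hw).unique (hasSum_single 0 fun k hk => by simp [hw0, hk])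
      simpa [ha0, hw0] using this
    · field_simp
  have hmem (t : ℝ) : exp (t * I) * z ∈ ball (0:ℂ) 1 := by
    rw [mem_ball_zero_iff, norm_exp_ofReal_mul_I_mul]; exact mem_ball_zero_iff.mp hz
  have hcont : Continuous fun t : ℝ => f (exp (t * I) * z) :=
    hdf.continuousOn.comp_continuous (by fun_prop) hmem
  have hmono := strictMono_argLift_im hH hz fun t => by
    have hw0 : exp (t * I) * z ≠ 0 := mul_ne_zero (exp_ne_zero _) hz0
    obtain ⟨hw, hre⟩ := hstar _ (hmem t) hw0
    rw [mul_deriv_div_eq hH hfH (hmem t) hw, add_re, one_re] at hre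
    linarith
  have hψ0 : (argLift H z 0).im = 0 := by simp [argLift]
  have hψ1 : (argLift H z (2 * Real.pi)).im = Real.pi := by simp [argLift]
  set g : ℝ → ℝ := fun t => (partialSumKernel n t * (f (exp (t * I) * z) / f z)).re with hg
  have hgsin (t : ℝ) (ht : t ∈ Set.Ioo 0 (2 * Real.pi)) :
      ∃ r > 0, g t = (1 - Real.cos (n * t)) * r := by
    have h1 : 0 < Real.sin (t / 2) :=
      Real.sin_pos_of_pos_of_lt_pi (by linarith [ht.1]) (by linarith [ht.2])
    have h2 : 0 < Real.sin (argLift H z t).im :=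
      Real.sin_pos_of_pos_of_lt_pi (hψ0 ▸ hmono ht.1) (hψ1 ▸ hmono ht.2)
    refine ⟨Real.exp (argLift H z t).re * Real.sin (argLift H z t).im / Real.sin (t / 2),
      by positivity, ?_⟩
    rw [← mul_div_assoc, eq_div_iff h1.ne', mul_comm]
    exact sin_mul_re_partialSumKernel_mul hfH hz hfz n t
  have hLcont : Continuous fun t : ℝ =>
      partialSumKernel n t * (f (exp (t * I) * z) / f z) :=
    (continuous_partialSumKernel n).mul (hcont.div_const _)
  have hgcont : Continuous g := continuous_re.comp hLcont
  have hpi := Real.pi_pos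
  have hn1 : (1:ℝ) ≤ n := Nat.one_le_cast.mpr (Nat.one_le_iff_ne_zero.mpr hn)
  have hpin : Real.pi / n < 2 * Real.pi := by linarith [div_le_self hpi.le hn1]
  have hpos : 0 < ∫ t in (0:ℝ)..2 * Real.pi, g t := by
    refine intervalIntegral.integral_pos (by positivity) hgcont.continuousOn (fun t ht => ?_)
      ⟨Real.pi / n, ⟨by positivity, hpin.le⟩, ?_⟩
    · rcases ht.2.eq_or_lt with rfl | ht2
      · simp [hg, partialSumKernel_two_pi]
      · obtain ⟨r, hr, h⟩ := hgsin t ⟨ht.1, ht2⟩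
        rw [h]
        exact mul_nonneg (sub_nonneg.mpr (Real.cos_le_one _)) hr.le
    · obtain ⟨r, hr, h⟩ := hgsin (Real.pi / n) ⟨by positivity, hpin⟩
      rw [h, mul_div_cancel₀ _ (by positivity), Real.cos_pi]
      linarith
  have hint : ∫ t in (0:ℝ)..2 * Real.pi, partialSumKernel n t * (f (exp (t * I) * z) / f z) =
      (2 * Real.pi : ℝ) * ((∑ k ∈ range (n + 1), a k * z ^ k) / f z) := by
    simp_rw [← mul_div_assoc]
    rw [intervalIntegral.integral_div, integral_partialSumKernel_mul ha0 hf hz hcont]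
    push_cast; rfl
  have hre : ∫ t in (0:ℝ)..2 * Real.pi, g t =
      2 * Real.pi * ((∑ k ∈ range (n + 1), a k * z ^ k) / f z).re := by
    rw [← re_ofReal_mul, ← hint]
    exact reCLM.intervalIntegral_comp_comm (hLcont.intervalIntegrable _ _)
  rw [hre] at hpos
  exact pos_of_mul_pos_right hpos (by positivity)

/-- Singh–Paul theorem (nonnegative-parameter case): if f is starlike of order 1/2
and λ, μ ≥ 0 with λ + μ > 0, then Re(λ zf'(z)/f(z) + μ f_n(z)/f(z)) > 0 on 𝔻. -/
theorem singh_paul_combination_positive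
    (f : ℂ → ℂ) (a : ℕ → ℂ) (ha0 : a 0 = 0) (ha1 : a 1 = 1)
    (hf : ∀ z ∈ ball (0:ℂ) 1, HasSum (fun k => a k * z ^ k) (f z))
    (hstar : ∀ z ∈ ball (0:ℂ) 1, z ≠ 0 →
      f z ≠ 0 ∧ 1/2 < (z * deriv f z / f z).re)
    (l m : ℝ) (hl : 0 ≤ l) (hm : 0 ≤ m) (hlm : 0 < l + m)
    (n : ℕ) (hn : 2 ≤ n) :
    ∀ z ∈ ball (0:ℂ) 1, z ≠ 0 →
      0 < ((l : ℂ) * (z * deriv f z / f z) +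
           (m : ℂ) * ((∑ k ∈ Finset.range (n+1), a k * z ^ k) / f z)).re := by
  intro z hz hz0
  have h1 : 0 < (z * deriv f z / f z).re := one_half_pos.trans (hstar z hz hz0).2
  have h2 := re_partialSum_div_pos ha0 ha1 hf hstar (by omega : n ≠ 0) hz hz0
  rw [add_re, re_ofReal_mul, re_ofReal_mul]
  rcases hl.eq_or_lt with rfl | hl
  · rw [zero_add] at hlm
    positivity
  · positivity
end

section
/- If f is a normalized analytic function on the unit disk 𝔻 satisfying Re f'(z) > 0 for all z ∈ 𝔻, then for every n ≥ 2 the n-th partial sum f_n is injective on the disk {z : |z| < 1/2}. -/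
open Complex Metric Finset
open scoped ComplexConjugate

/-- **Noshiro–Warschawski**: a function whose derivative has positive real part on a convex set
is injective there. -/
theorem Convex.injOn_of_re_hasDerivAt_pos {s : Set ℂ} (hs : Convex ℝ s) {F F' : ℂ → ℂ}
    (hF : ∀ z ∈ s, HasDerivAt F (F' z) z) (hpos : ∀ z ∈ s, 0 < (F' z).re) :
    Set.InjOn F s := by
  intro x hx y hy hxy
  by_contra hne
  set d : ℂ := y - x with hd
  have hd0 : 0 < normSq d := normSq_pos.2 (sub_ne_zero.2 (Ne.symm hne))
  have hmem : ∀ t ∈ Set.Icc (0 : ℝ) 1, x + t * d ∈ s := fun t ht ↦ by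
    simpa using hs.add_smul_sub_mem hx hy ht
  have hder : ∀ t ∈ Set.Icc (0 : ℝ) 1, HasDerivAt (fun t : ℝ ↦ (F (x + t * d) * conj d).re)
      ((F' (x + t * d)).re * normSq d) t := fun t ht ↦ by
    have h1 : HasDerivAt (fun w : ℂ ↦ x + w * d) d (t : ℂ) := by
      simpa using ((hasDerivAt_id (t : ℂ)).mul_const d).const_add x
    convert! (((hF _ (hmem t ht)).comp (t : ℂ) h1).mul_const (conj d)).real_of_complex using 1
    rw [mul_assoc, mul_conj, re_mul_ofReal]
  obtain ⟨t, ht, hslope⟩ := exists_hasDerivAt_eq_slope _ _ zero_lt_one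
    (fun t ht ↦ (hder t ht).continuousAt.continuousWithinAt)
    (fun t ht ↦ hder t (Set.Ioo_subset_Icc_self ht))
  have hzero : (F' (x + t * d)).re * normSq d = 0 := by
    rw [hslope]
    simp [hd, hxy]
  exact (mul_pos (hpos _ (hmem t (Set.Ioo_subset_Icc_self ht))) hd0).ne' hzero

theorem re_two_mul_geom_sum_sub_one_pos {u : ℂ} (hu : ‖u‖ < 1 / 2) {m : ℕ} (hm : 1 ≤ m) :
    0 < (2 * ∑ k ∈ range (m + 1), u ^ k - 1).re := by
  obtain rfl | hm := hm.eq_or_lt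
  · have := (abs_le.1 (abs_re_le_norm u)).1
    simp [sum_range_succ]
    linarith
  set r := ‖u‖ with hr
  have hr0 : 0 ≤ r := norm_nonneg u
  have hgeom : (2 * ∑ k ∈ range (m + 1), u ^ k - 1) * (normSq (1 - u) : ℂ) =
      (1 + u) * conj (1 - u) - 2 * u ^ (m + 1) * conj (1 - u) := by
    rw [← mul_conj]
    linear_combination (2 * conj (1 - u)) * geom_sum_mul_neg u (m + 1)
  have hmain : ((1 + u) * conj (1 - u)).re = 1 - r ^ 2 := by
    rw [hr, ← normSq_eq_norm_sq, normSq_apply]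
    simp
    ring
  have htail : (2 * u ^ (m + 1) * conj (1 - u)).re ≤ 2 * r ^ 3 * (1 + r) := by
    refine (re_le_norm _).trans ?_
    rw [norm_mul, norm_mul, norm_pow, norm_conj, ← hr, norm_ofNat]
    have h1 : r ^ (m + 1) ≤ r ^ 3 := pow_le_pow_of_le_one hr0 (by linarith) (by omega)
    have h2 : ‖1 - u‖ ≤ 1 + r := by simpa using norm_sub_le (1 : ℂ) u
    gcongr
  have hre := congrArg re hgeom
  rw [re_mul_ofReal, sub_re ((1 + u) * _), hmain] at hre
  refine pos_of_mul_pos_left (b := normSq (1 - u)) ?_ (normSq_nonneg _)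
  rw [hre]
  have h3 : r ^ 3 ≤ 1 / 8 := by
    calc r ^ 3 ≤ (1 / 2) ^ 3 := by gcongr
      _ = 1 / 8 := by norm_num
  nlinarith

theorem Real.circleAverage_pos {g : ℂ → ℝ} {c : ℂ} {R : ℝ} (hg : ContinuousOn g (sphere c |R|))
    (hpos : ∀ w ∈ sphere c |R|, 0 < g w) : 0 < Real.circleAverage g c R := by
  obtain ⟨w, hw, hmin⟩ := (isCompact_sphere c |R|).exists_isMinOn
    (NormedSpace.sphere_nonempty.2 (abs_nonneg R)) hg
  calc 0 < g w := hpos w hw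
    _ = Real.circleAverage (fun _ ↦ g w) c R := (Real.circleAverage_const _ _ _).symm
    _ ≤ Real.circleAverage g c R :=
      Real.circleAverage_mono (circleIntegrable_const _ _ _) hg.circleIntegrable' hmin

theorem DiffContOnCl.circleAverage_mul_div_pow {p : ℂ → ℂ} {R : ℝ} (hR : 0 < R)
    (hp : DiffContOnCl ℂ p (ball 0 R)) (z : ℂ) (k : ℕ) :
    Real.circleAverage (fun w ↦ p w * (z / w) ^ k) 0 R =
      iteratedDeriv k p 0 / k.factorial * z ^ k := by
  have h := hp.circleIntegral_one_div_sub_center_pow_smul hR k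
  rw [Real.circleAverage_eq_circleIntegral hR.ne']
  have : (fun w : ℂ ↦ (w - 0)⁻¹ • (p w * (z / w) ^ k)) =
      fun w ↦ z ^ k • ((1 / (w - 0) ^ (k + 1)) • p w) := by
    ext w
    simp only [smul_eq_mul, sub_zero, div_pow, pow_succ, one_div, mul_inv]
    ring
  rw [this, circleIntegral.integral_smul, h]
  simp only [smul_eq_mul]
  field_simp [two_pi_I_ne_zero]

/-- The real part of a Taylor partial sum of `p` is the average of `re p` against a
Dirichlet-type kernel. -/
theorem re_taylor_sum_eq_circleAverage {p : ℂ → ℂ} {R : ℝ} (hR : 0 < R)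
    (hp : DiffContOnCl ℂ p (ball 0 R)) (z : ℂ) (m : ℕ) :
    (∑ k ∈ range (m + 1), iteratedDeriv k p 0 / k.factorial * z ^ k).re =
      Real.circleAverage
        (fun w ↦ (p w).re * (2 * ∑ k ∈ range (m + 1), (z / w) ^ k - 1).re) 0 R := by
  have hsphere : ∀ w ∈ sphere (0 : ℂ) |R|, w ≠ 0 := fun w hw ↦
    ne_of_mem_sphere hw (abs_pos.2 hR.ne').ne'
  have hpc : ContinuousOn p (sphere 0 |R|) := by
    rw [abs_of_pos hR]
    exact hp.continuousOn_ball.mono sphere_subset_closedBall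
  have hterm : ∀ k, ContinuousOn (fun w ↦ p w * (z / w) ^ k) (sphere 0 |R|) := fun k ↦
    hpc.mul ((continuousOn_const.div continuousOn_id hsphere).pow k)
  set q : ℂ → ℂ := fun w ↦ ∑ k ∈ range (m + 1), (conj z * w / R ^ 2) ^ k - 1 with hq
  have hqd : Differentiable ℂ q := by fun_prop
  have hq0 : q 0 = 0 := by simp [hq, sum_range_succ']
  have hpq : DiffContOnCl ℂ (fun w ↦ p w * q w) (ball 0 |R|) := by
    rw [abs_of_pos hR]
    exact hp.smul hqd.diffContOnCl
  have hpqc : ContinuousOn (fun w ↦ p w * q w) (sphere 0 |R|) := hpc.mul hqd.continuous.continuousOn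
  have hsum : Real.circleAverage
      (fun w ↦ (∑ k ∈ range (m + 1), p w * (z / w) ^ k) + p w * q w) 0 R =
      ∑ k ∈ range (m + 1), iteratedDeriv k p 0 / k.factorial * z ^ k := by
    rw [Real.circleAverage_fun_add
      (continuousOn_finsetSum _ fun k _ ↦ hterm k).circleIntegrable' hpqc.circleIntegrable',
      Real.circleAverage_fun_sum fun k _ ↦ (hterm k).circleIntegrable', hpq.circleAverage, hq0,
      mul_zero, add_zero]
    exact sum_congr rfl fun k _ ↦ hp.circleAverage_mul_div_pow hR z k
  have hint := ((continuousOn_finsetSum (range (m + 1)) fun k _ ↦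
    hterm k).add hpqc).circleIntegrable'
  rw [← hsum, ← reCLM_apply]
  refine (reCLM.circleAverage_comp_comm hint).symm.trans ?_
  refine Real.circleAverage_congr_sphere fun w hw ↦ ?_
  have hw0 := hsphere w hw
  have hwR : w * conj w = R ^ 2 := by
    rw [mul_conj, normSq_eq_norm_sq, mem_sphere_zero_iff_norm.1 hw, sq_abs]
    push_cast
    rfl
  have hcw : conj w ≠ 0 := (map_ne_zero _).2 hw0
  have hqw : q w = conj (∑ k ∈ range (m + 1), (z / w) ^ k) - 1 := by
    simp only [hq, ← hwR, map_sum, map_pow, map_div₀]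
    congr 2 with k
    congr 1
    field_simp
  change (∑ k ∈ range (m + 1), p w * (z / w) ^ k + p w * q w).re = _
  rw [hqw, ← mul_sum]
  generalize ∑ k ∈ range (m + 1), (z / w) ^ k = S
  simp
  ring

theorem re_taylor_sum_pos {p : ℂ → ℂ} (hp : DifferentiableOn ℂ p (ball 0 1))
    (hre : ∀ z ∈ ball (0 : ℂ) 1, 0 < (p z).re) {m : ℕ} (hm : 1 ≤ m) {z : ℂ}
    (hz : ‖z‖ < 1 / 2) :
    0 < (∑ k ∈ range (m + 1), iteratedDeriv k p 0 / k.factorial * z ^ k).re := by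
  obtain ⟨R, hzR, hR1⟩ := exists_between (show 2 * ‖z‖ < 1 by linarith)
  have hR : 0 < R := (by positivity : 0 ≤ 2 * ‖z‖).trans_lt hzR
  have hsub : closedBall (0 : ℂ) R ⊆ ball 0 1 := closedBall_subset_ball hR1
  have hd : DiffContOnCl ℂ p (ball 0 R) :=
    (hp.mono (closure_ball_subset_closedBall.trans hsub)).diffContOnCl
  have hmem : ∀ w ∈ sphere (0 : ℂ) |R|, w ∈ ball (0 : ℂ) 1 ∧ w ≠ 0 := fun w hw ↦ by
    rw [abs_of_pos hR] at hw
    exact ⟨hsub (sphere_subset_closedBall hw), ne_of_mem_sphere hw hR.ne'⟩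
  rw [re_taylor_sum_eq_circleAverage hR hd]
  refine Real.circleAverage_pos ?_ fun w hw ↦ ?_
  · refine (continuous_re.comp_continuousOn
      (hp.continuousOn.mono fun w hw ↦ (hmem w hw).1)).mul (continuous_re.comp_continuousOn ?_)
    exact (continuousOn_const.mul (continuousOn_finsetSum _ fun k _ ↦
      (continuousOn_const.div continuousOn_id fun w hw ↦ (hmem w hw).2).pow k)).sub
      continuousOn_const
  · refine mul_pos (hre w (hmem w hw).1) (re_two_mul_geom_sum_sub_one_pos ?_ hm)
    rw [norm_div, mem_sphere_zero_iff_norm.1 hw, abs_of_pos hR, div_lt_iff₀ hR]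
    linarith

theorem hasFPowerSeriesOnBall_ofScalars_of_hasSum {f : ℂ → ℂ} {a : ℕ → ℂ}
    (hf : ∀ z ∈ ball (0 : ℂ) 1, HasSum (fun k ↦ a k * z ^ k) (f z)) :
    HasFPowerSeriesOnBall f (FormalMultilinearSeries.ofScalars ℂ a) 0 1 where
  r_le := by
    refine ENNReal.le_of_forall_nnreal_lt fun r hr ↦ ?_
    have hr1 : (r : ℝ) < 1 := mod_cast hr
    refine FormalMultilinearSeries.le_radius_of_tendsto _ (l := 0) ?_
    have h := (hf (r : ℝ) (by simpa using hr1)).summable.tendsto_atTop_zero.norm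
    simpa [FormalMultilinearSeries.norm_apply_eq_norm_coef] using h
  r_pos := one_pos
  hasSum := fun {y} hy ↦ by
    have hy1 : y ∈ ball (0 : ℂ) 1 := by
      simpa only [← ENNReal.ofReal_one, eball_ofReal] using hy
    simpa [mul_comm] using hf y hy1

/-- MacGregor's theorem: if Re f'(z) > 0 on the unit disk, then every partial sum
f_n (n ≥ 2) is injective on the disk of radius 1/2. -/
theorem macgregor_partial_sum_univalent
    (f : ℂ → ℂ) (a : ℕ → ℂ) (ha0 : a 0 = 0) (ha1 : a 1 = 1)
    (hf : ∀ z ∈ ball (0:ℂ) 1, HasSum (fun k => a k * z ^ k) (f z))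
    (hre : ∀ z ∈ ball (0:ℂ) 1, 0 < (deriv f z).re)
    (n : ℕ) (hn : 2 ≤ n) :
    Set.InjOn (fun z => ∑ k ∈ Finset.range (n+1), a k * z ^ k)
      (ball (0:ℂ) (1/2)) := by
  have hps := hasFPowerSeriesOnBall_ofScalars_of_hasSum hf
  have hfd : DifferentiableOn ℂ f (ball 0 1) := by
    simpa [← eball_ofReal] using hps.differentiableOn
  have hcoeff : ∀ k, a k = iteratedDeriv k f 0 / k.factorial := fun k ↦ by
    have h := congrArg (fun q ↦ q.coeff k) (hps.hasFPowerSeriesAt.eq_formalMultilinearSeries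
      hps.analyticAt.hasFPowerSeriesAt)
    simpa [FormalMultilinearSeries.coeff_ofScalars] using h
  obtain ⟨m, rfl⟩ : ∃ m, n = m + 1 := ⟨n - 1, by omega⟩
  refine (convex_ball _ _).injOn_of_re_hasDerivAt_pos
    (F' := fun z ↦ ∑ k ∈ range (m + 1), iteratedDeriv k (deriv f) 0 / k.factorial * z ^ k)
    (fun z _ ↦ ?_)
    fun z hz ↦ re_taylor_sum_pos (hfd.deriv isOpen_ball) hre (by omega) (by simpa using hz)
  have h := HasDerivAt.fun_sum (u := range (m + 1 + 1))
    fun k _ ↦ (hasDerivAt_pow k z).const_mul (a k)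
  convert! h using 1
  rw [sum_range_succ' _ (m + 1)]
  simp only [Nat.cast_zero, zero_mul, mul_zero, add_zero]
  refine sum_congr rfl fun k _ ↦ ?_
  rw [hcoeff, iteratedDeriv_succ', Nat.factorial_succ, Nat.add_sub_cancel]
  push_cast
  have : (k : ℂ) + 1 ≠ 0 := Nat.cast_add_one_ne_zero k
  field_simp
end
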